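/- arXiv:1708.09590 — 8 statements merged into one kernel-verified Lean document; each statement's English description precedes it below -/
import Mathlib

section
/- Let p ∈ (0,1) and μ₁₁ > 0. Let x : [0,∞) → ℝ be a continuous function with x(0) = 0 and let u : [0,∞) → ℝ be a continuous nondecreasing function with u(0) = 0, such that x(t) + p·μ₁₁·∫₀ᵗ x(s) ds = (1−p)·u(t) for all t ≥ 0. Then x(t) ≥ 0 for all t ≥ 0. -/
/-- Let `p ∈ (0,1)` and `μ₁₁ > 0`. Let `x : [0,∞) → ℝ` be continuous with
`x 0 = 0` and `u : [0,∞) → ℝ` continuous nondecreasing with `u 0 = 0`, such that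
`x t + p·μ₁₁·∫₀ᵗ x(s) ds = (1−p)·u t` for all `t ≥ 0`. Then `x t ≥ 0` for all `t ≥ 0`. -/
theorem stmt_0 (p μ11 : ℝ) (hp0 : 0 < p) (hp1 : p < 1) (hμ11 : 0 < μ11)
    (x u : ℝ → ℝ)
    (hx : ContinuousOn x (Set.Ici 0)) (hx0 : x 0 = 0)
    (hu : ContinuousOn u (Set.Ici 0)) (hu0 : u 0 = 0)
    (humono : MonotoneOn u (Set.Ici 0))
    (heq : ∀ t ≥ (0 : ℝ), x t + p * μ11 * ∫ s in (0:ℝ)..t, x s = (1 - p) * u t) :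
    ∀ t ≥ (0 : ℝ), 0 ≤ x t := by
  intro t ht
  by_contra! hneg
  -- `s` is the last time before `t` at which `x` is nonnegative.
  have hcompact : IsCompact (Set.Icc 0 t ∩ x ⁻¹' Set.Ici 0) :=
    isCompact_Icc.of_isClosed_subset
      ((hx.mono Set.Icc_subset_Ici_self).preimage_isClosed_of_isClosed isClosed_Icc isClosed_Ici)
      Set.inter_subset_left
  obtain ⟨s, ⟨⟨hs0, hst⟩, hxs⟩, hmax⟩ :=
    hcompact.exists_isGreatest ⟨0, ⟨le_rfl, ht⟩, hx0.ge⟩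
  have hint : ∀ a b : ℝ, 0 ≤ a → 0 ≤ b → IntervalIntegrable x MeasureTheory.volume a b :=
    fun a b ha hb => (hx.mono fun r hr => (le_min ha hb).trans hr.1).intervalIntegrable
  have hnonpos : ∫ r in s..t, x r ≤ 0 := by
    have h := intervalIntegral.integral_mono_on_of_le_Ioo hst (hint s t hs0 ht)
      (intervalIntegrable_const (c := (0 : ℝ))) fun r hr => by
        by_contra! hr0
        exact hr.1.not_ge (hmax ⟨⟨hs0.trans hr.1.le, hr.2.le⟩, hr0.le⟩)
    simpa using h
  have hadd := intervalIntegral.integral_add_adjacent_intervals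
    (hint 0 s le_rfl hs0) (hint s t hs0 ht)
  have hut : (1 - p) * u s ≤ (1 - p) * u t :=
    mul_le_mul_of_nonneg_left (humono hs0 ht hst) (sub_nonneg.2 hp1.le)
  have hmul := mul_nonpos_of_nonneg_of_nonpos (mul_pos hp0 hμ11).le hnonpos
  have hes := heq s hs0
  have het := heq t ht
  rw [← hadd, mul_add] at het
  have hxs' : 0 ≤ x s := hxs
  linarith
end

section
/- Let y*, y, u be a solution of the fluid system (Sk01). Then for all t ≥ 0, y*(t) + y(t) ≥ h̄(t), where h̄(t) = (y*(0)+y(0))·e^{−pμ₁₁ t} + (1 − (1−p)μ₀₂ r/(p μ₁₁))·(1 − e^{−pμ₁₁ t}). -/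
/-- A comparison principle: a solution of `z' = a (1 - z) - c` in integral form, pushed upwards by a
nonnegative nondecreasing term `v`, lies above the solution without the push. -/
theorem exp_relaxation_le_of_monotone_push {a c : ℝ} (ha : 0 < a) {z v : ℝ → ℝ}
    (hz : ContinuousOn z (Set.Ici 0)) (hv : MonotoneOn v (Set.Ici 0)) (hv0 : v 0 = 0)
    (heq : ∀ t ≥ (0 : ℝ), z t = z 0 + a * (∫ s in (0:ℝ)..t, (1 - z s)) - c * t + v t)
    {T : ℝ} (hT : 0 ≤ T) :
    z 0 * Real.exp (-a * T) + (1 - c / a) * (1 - Real.exp (-a * T)) ≤ z T := by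
  have hvT : 0 ≤ v T := hv0 ▸ hv Set.self_mem_Ici hT hT
  have hg : Continuous fun s => 1 - z (max s 0) :=
    continuous_const.sub (hz.comp_continuous (by fun_prop) fun s => le_max_right s 0)
  have hint : ∀ t ≥ (0 : ℝ),
      ∫ s in (0:ℝ)..t, (1 - z s) = ∫ s in (0:ℝ)..t, (1 - z (max s 0)) := by
    intro t ht
    refine intervalIntegral.integral_congr fun s hs => ?_
    rw [Set.uIcc_of_le ht] at hs
    simp only [max_eq_left hs.1]
  set f : ℝ → ℝ := fun t => Real.exp (a * t) *
    (z 0 + a * (∫ s in (0:ℝ)..t, (1 - z (max s 0))) - c * t - (1 - c / a) + v T) with hf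
  have hf_eq : ∀ t ≥ (0 : ℝ), f t = Real.exp (a * t) * (z t - v t - (1 - c / a) + v T) := by
    intro t ht
    have h := heq t ht
    rw [hint t ht] at h
    simp only [hf]
    rw [h]
    ring
  have hderiv : ∀ t, HasDerivAt f (Real.exp (a * t) * a *
      (z 0 + a * (∫ s in (0:ℝ)..t, (1 - z (max s 0))) - c * t - (1 - c / a) + v T) +
      Real.exp (a * t) * (a * (1 - z (max t 0)) - c)) t := by
    intro t
    have hF := (hg.integral_hasStrictDerivAt 0 t).hasDerivAt
    have hE : HasDerivAt (fun t => Real.exp (a * t)) (Real.exp (a * t) * a) t := by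
      simpa using ((hasDerivAt_id t).const_mul a).exp
    have hC : HasDerivAt (fun t => c * t) c t := by
      simpa using (hasDerivAt_id t).const_mul c
    exact hE.mul (((((hF.const_mul a).const_add (z 0)).sub hC).sub_const _).add_const _)
  have hmono : MonotoneOn f (Set.Icc 0 T) := by
    refine monotoneOn_of_deriv_nonneg (convex_Icc 0 T)
      (fun t _ => (hderiv t).continuousAt.continuousWithinAt)
      (fun t _ => (hderiv t).differentiableAt.differentiableWithinAt) fun t ht => ?_
    rw [interior_Icc] at ht
    have h := heq t ht.1.le
    rw [hint t ht.1.le] at h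
    have hvt : v t ≤ v T := hv ht.1.le hT ht.2.le
    have key : deriv f t = Real.exp (a * t) * (a * (v T - v t)) := by
      rw [(hderiv t).deriv, max_eq_left ht.1.le, h]
      field_simp
      ring
    rw [key]
    exact mul_nonneg (Real.exp_pos _).le (mul_nonneg ha.le (sub_nonneg.2 hvt))
  have hle := hmono (Set.left_mem_Icc.2 hT) (Set.right_mem_Icc.2 hT) hT
  rw [hf_eq 0 le_rfl, hf_eq T hT, hv0, mul_zero, Real.exp_zero, one_mul] at hle
  have hexp : Real.exp (-a * T) * Real.exp (a * T) = 1 := by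
    rw [← Real.exp_add]
    simp
  have hmul := mul_le_mul_of_nonneg_left hle (Real.exp_pos (-a * T)).le
  rw [← mul_assoc, hexp] at hmul
  nlinarith [mul_nonneg (Real.exp_pos (-a * T)).le hvT]

/-- for any solution `(y*, y, u)` of the fluid system (Sk01), for all `t ≥ 0`,
`y*(t) + y(t) ≥ h̄(t)` where
`h̄(t) = (y*(0)+y(0))·e^{−pμ₁₁ t} + (1 − (1−p)μ₀₂ r/(p μ₁₁))·(1 − e^{−pμ₁₁ t})`. -/
theorem stmt_1 (p μ01 μ11 μ02 r : ℝ)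
    (hp0 : 0 < p) (hp1 : p < 1) (hμ01 : 0 < μ01) (hμ11 : 0 < μ11) (hμ02 : 0 < μ02)
    (hr : 0 < r)
    (ystar y u : ℝ → ℝ)
    (hystar : ContinuousOn ystar (Set.Ici 0))
    (hy : ContinuousOn y (Set.Ici 0))
    (hu : ContinuousOn u (Set.Ici 0)) (humono : MonotoneOn u (Set.Ici 0)) (hu0 : u 0 = 0)
    (heq1 : ∀ t ≥ (0 : ℝ),
      ystar t = ystar 0 + μ01 * (∫ s in (0:ℝ)..t, y s) - μ02 * r * t + u t)
    (heq2 : ∀ t ≥ (0 : ℝ),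
      y t = y 0 - μ01 * (∫ s in (0:ℝ)..t, y s)
        + p * μ11 * (∫ s in (0:ℝ)..t, (1 - ystar s - y s))
        + p * μ02 * r * t - p * u t) :
    ∀ t ≥ (0 : ℝ),
      ystar t + y t ≥
        (ystar 0 + y 0) * Real.exp (-(p * μ11) * t)
          + (1 - (1 - p) * μ02 * r / (p * μ11)) * (1 - Real.exp (-(p * μ11) * t)) := by
  intro t ht
  have hsum : ∀ t ≥ (0 : ℝ), ystar t + y t = (ystar 0 + y 0)
      + p * μ11 * (∫ s in (0:ℝ)..t, (1 - (ystar s + y s))) - (1 - p) * μ02 * r * t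
      + (1 - p) * u t := by
    intro t ht
    have h1 := heq1 t ht
    have h2 := heq2 t ht
    simp only [sub_sub] at h2
    linear_combination h1 + h2
  exact exp_relaxation_le_of_monotone_push (z := fun t => ystar t + y t)
    (v := fun t => (1 - p) * u t) (mul_pos hp0 hμ11) (hystar.add hy)
    (fun s hs t ht hst => mul_le_mul_of_nonneg_left (humono hs ht hst) (sub_nonneg.2 hp1.le))
    (by simp [hu0]) hsum ht
end

section
/- Let y*, y, u be a solution of the fluid system (Sk01). Then for all t ≥ 0, ∫₀ᵗ y(s) ds = k(t)·e^{−μ̄ t} − p·∫₀ᵗ ( y*(s) + μ₁₁∫₀ˢ y*(v) dv )·e^{−μ̄(t−s)} ds, where μ̄ = (1−p)μ₀₁ + pμ₁₁ and k(t) = (1/μ̄)·(p·y*(0) + y(0))·(e^{μ̄ t} − 1) + (pμ₁₁/μ̄²)·(1 + (μ̄ t − 1)e^{μ̄ t}). Equivalently, μ₀₁∫₀ᵗ y(s) ds = G(y*)(t) + μ₀₁ k(t) e^{−μ̄ t}, where G(x)(t) = −pμ₀₁∫₀ᵗ ( x(s) + μ₁₁∫₀ˢ x(v) dv )·e^{−μ̄(t−s)}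 ds. -/
/-- The functional `G` with `μ̄ = (1−p)μ₀₁ + pμ₁₁`:
`G(x)(t) = −pμ₀₁ ∫₀ᵗ ( x(s) + μ₁₁ ∫₀ˢ x(v) dv )·e^{−μ̄(t−s)} ds`. -/
noncomputable def funcG (p μ01 μ11 : ℝ) (x : ℝ → ℝ) (t : ℝ) : ℝ :=
  -(p * μ01) * ∫ s in (0:ℝ)..t,
    (x s + μ11 * ∫ v in (0:ℝ)..s, x v)
      * Real.exp (-((1 - p) * μ01 + p * μ11) * (t - s))

theorem continuousOn_integral_Ici {f : ℝ → ℝ} (hf : ContinuousOn f (Set.Ici 0)) :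
    ContinuousOn (fun t => ∫ s in (0:ℝ)..t, f s) (Set.Ici 0) := by
  intro t ht
  have ht0 : (0:ℝ) ≤ t := ht
  have hint : MeasureTheory.IntegrableOn f (Set.uIcc 0 (t + 1)) := by
    rw [Set.uIcc_of_le (by linarith)]
    exact (hf.mono Set.Icc_subset_Ici_self).integrableOn_Icc
  have h := intervalIntegral.continuousOn_primitive_interval hint
  rw [Set.uIcc_of_le (by linarith)] at h
  refine (h t ⟨ht0, by linarith⟩).mono_of_mem_nhdsWithin ?_
  rw [← Set.Ici_inter_Iic]
  exact Filter.inter_mem self_mem_nhdsWithin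
    (mem_nhdsWithin_of_mem_nhds (Iic_mem_nhds (by linarith)))

theorem intervalIntegrable_of_continuousOn_Ici {f : ℝ → ℝ} (hf : ContinuousOn f (Set.Ici 0))
    {t : ℝ} (ht : 0 ≤ t) : IntervalIntegrable f MeasureTheory.volume 0 t :=
  ContinuousOn.intervalIntegrable_of_Icc ht (hf.mono Set.Icc_subset_Ici_self)

theorem hasDerivAt_integral_of_continuousOn_Ici {f : ℝ → ℝ} (hf : ContinuousOn f (Set.Ici 0))
    {t : ℝ} (ht : 0 < t) : HasDerivAt (fun t => ∫ s in (0:ℝ)..t, f s) (f t) t :=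
  intervalIntegral.integral_hasDerivAt_right
    (intervalIntegrable_of_continuousOn_Ici hf ht.le)
    ((hf.mono Set.Ioi_subset_Ici_self).stronglyMeasurableAtFilter isOpen_Ioi t ht)
    (hf.continuousAt (Ici_mem_nhds ht))

/-- Variation of constants for `Y' = c - m Y + b t - f`, where `Y` is the primitive of `y`
vanishing at `0`. -/
theorem integral_eq_of_linear_equation {m c b : ℝ} (hm : m ≠ 0) {y f : ℝ → ℝ}
    (hy : ContinuousOn y (Set.Ici 0)) (hf : ContinuousOn f (Set.Ici 0))
    (h : ∀ t ≥ (0:ℝ), y t = c - m * (∫ s in (0:ℝ)..t, y s) + b * t - f t)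
    {t : ℝ} (ht : 0 ≤ t) :
    (∫ s in (0:ℝ)..t, y s) =
      (1 / m * c * (Real.exp (m * t) - 1)
          + b / m ^ 2 * (1 + (m * t - 1) * Real.exp (m * t))) * Real.exp (-m * t)
        - ∫ s in (0:ℝ)..t, f s * Real.exp (-m * (t - s)) := by
  have hexp : ∀ s, HasDerivAt (fun s => Real.exp (m * s)) (Real.exp (m * s) * m) s := fun s => by
    simpa using ((hasDerivAt_id s).const_mul m).exp
  have hlin : ∀ s, HasDerivAt (fun s => m * s - 1) m s := fun s => by
    simpa using ((hasDerivAt_id s).const_mul m).sub_const 1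
  have hE : Continuous fun s : ℝ => Real.exp (m * s) := by fun_prop
  have key : ∫ s in (0:ℝ)..t, f s * Real.exp (m * s) = _ :=
    intervalIntegral.integral_eq_sub_of_hasDerivAt_of_le (f := fun s =>
      1 / m * c * (Real.exp (m * s) - 1) + b / m ^ 2 * (1 + (m * s - 1) * Real.exp (m * s))
        - (∫ v in (0:ℝ)..s, y v) * Real.exp (m * s)) ht
      (by
        have hY := (continuousOn_integral_Ici hy).mono (Set.Icc_subset_Ici_self : Set.Icc 0 t ⊆ _)
        exact ContinuousOn.sub (Continuous.continuousOn (by fun_prop)) (hY.mul hE.continuousOn))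
      (fun s hs => by
        have hd := ((((hexp s).sub_const 1).const_mul (1 / m * c)).add
          ((((hlin s).mul (hexp s)).const_add 1).const_mul (b / m ^ 2))).sub
          ((hasDerivAt_integral_of_continuousOn_Ici hy hs.1).mul (hexp s))
        refine hd.congr_deriv ?_
        rw [h s hs.1.le]
        field_simp
        ring)
      (intervalIntegrable_of_continuousOn_Ici (hf.mul hE.continuousOn) ht)
  have hfac : ∫ s in (0:ℝ)..t, f s * Real.exp (-m * (t - s)) =
      (∫ s in (0:ℝ)..t, f s * Real.exp (m * s)) * Real.exp (-m * t) := by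
    rw [← intervalIntegral.integral_mul_const]
    congr 1 with s
    rw [mul_assoc, ← Real.exp_add]
    ring_nf
  have hinv : Real.exp (m * t) * Real.exp (-m * t) = 1 := by
    rw [← Real.exp_add]
    simp
  rw [hfac, key]
  simp only [intervalIntegral.integral_same, mul_zero, Real.exp_zero]
  linear_combination -(∫ s in (0:ℝ)..t, y s) * hinv

/-- for any solution `(y*, y, u)` of the fluid system (Sk01), for all `t ≥ 0`,
`∫₀ᵗ y(s) ds = k(t)·e^{−μ̄ t} − p ∫₀ᵗ ( y*(s) + μ₁₁∫₀ˢ y*(v) dv )·e^{−μ̄(t−s)} ds`, with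
`μ̄ = (1−p)μ₀₁ + pμ₁₁` and
`k(t) = (1/μ̄)(p y*(0) + y(0))(e^{μ̄ t} − 1) + (pμ₁₁/μ̄²)(1 + (μ̄ t − 1)e^{μ̄ t})`;
equivalently `μ₀₁∫₀ᵗ y(s) ds = G(y*)(t) + μ₀₁ k(t) e^{−μ̄ t}`. -/
theorem stmt_3 (p μ01 μ11 μ02 r : ℝ)
    (hp0 : 0 < p) (hp1 : p < 1) (hμ01 : 0 < μ01) (hμ11 : 0 < μ11) (hμ02 : 0 < μ02)
    (hr : 0 < r)
    (ystar y u : ℝ → ℝ)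
    (hystar : ContinuousOn ystar (Set.Ici 0))
    (hy : ContinuousOn y (Set.Ici 0))
    (hu : ContinuousOn u (Set.Ici 0)) (humono : MonotoneOn u (Set.Ici 0)) (hu0 : u 0 = 0)
    (heq1 : ∀ t ≥ (0 : ℝ),
      ystar t = ystar 0 + μ01 * (∫ s in (0:ℝ)..t, y s) - μ02 * r * t + u t)
    (heq2 : ∀ t ≥ (0 : ℝ),
      y t = y 0 - μ01 * (∫ s in (0:ℝ)..t, y s)
        + p * μ11 * (∫ s in (0:ℝ)..t, (1 - ystar s - y s))
        + p * μ02 * r * t - p * u t) :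
    ∀ t ≥ (0 : ℝ),
      (∫ s in (0:ℝ)..t, y s) =
        ((1 / ((1 - p) * μ01 + p * μ11)) * (p * ystar 0 + y 0)
            * (Real.exp (((1 - p) * μ01 + p * μ11) * t) - 1)
          + (p * μ11 / ((1 - p) * μ01 + p * μ11) ^ 2)
            * (1 + (((1 - p) * μ01 + p * μ11) * t - 1)
                * Real.exp (((1 - p) * μ01 + p * μ11) * t)))
          * Real.exp (-((1 - p) * μ01 + p * μ11) * t)
        - p * ∫ s in (0:ℝ)..t,
            (ystar s + μ11 * ∫ v in (0:ℝ)..s, ystar v)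
              * Real.exp (-((1 - p) * μ01 + p * μ11) * (t - s)) ∧
      μ01 * (∫ s in (0:ℝ)..t, y s) =
        funcG p μ01 μ11 ystar t
          + μ01 * ((1 / ((1 - p) * μ01 + p * μ11)) * (p * ystar 0 + y 0)
                * (Real.exp (((1 - p) * μ01 + p * μ11) * t) - 1)
              + (p * μ11 / ((1 - p) * μ01 + p * μ11) ^ 2)
                * (1 + (((1 - p) * μ01 + p * μ11) * t - 1)
                    * Real.exp (((1 - p) * μ01 + p * μ11) * t)))
            * Real.exp (-((1 - p) * μ01 + p * μ11) * t) := by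
  intro t ht
  have hm : (1 - p) * μ01 + p * μ11 ≠ 0 := by
    have h1 : 0 < 1 - p := by linarith
    positivity
  have hf : ContinuousOn (fun s => p * (ystar s + μ11 * ∫ v in (0:ℝ)..s, ystar v))
      (Set.Ici 0) :=
    continuousOn_const.mul
      (hystar.add (continuousOn_const.mul (continuousOn_integral_Ici hystar)))
  have hlin : ∀ t ≥ (0:ℝ), y t = (p * ystar 0 + y 0)
      - ((1 - p) * μ01 + p * μ11) * (∫ s in (0:ℝ)..t, y s) + p * μ11 * t
      - p * (ystar t + μ11 * ∫ v in (0:ℝ)..t, ystar v) := by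
    intro t ht
    have hys := intervalIntegrable_of_continuousOn_Ici hystar ht
    have hsplit : (∫ s in (0:ℝ)..t, (1 - ystar s - y s)) =
        t - (∫ s in (0:ℝ)..t, ystar s) - ∫ s in (0:ℝ)..t, y s := by
      rw [intervalIntegral.integral_sub (intervalIntegrable_const.sub hys)
        (intervalIntegrable_of_continuousOn_Ici hy ht),
        intervalIntegral.integral_sub intervalIntegrable_const hys]
      simp
    have h2 := heq2 t ht
    rw [hsplit] at h2
    linear_combination h2 + p * heq1 t ht
  have main := integral_eq_of_linear_equation hm hy hf hlin ht
  simp only [mul_assoc p (_ + _) (Real.exp _), intervalIntegral.integral_const_mul] at main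
  refine ⟨main, ?_⟩
  rw [funcG]
  linear_combination μ01 * main
end

section
/- Let a, b : [0,∞) → ℝ be continuous functions. Then for every t ≥ 0, sup_{0 ≤ s ≤ t} |G(a)(s) − G(b)(s)| ≤ C_t · ∫₀ᵗ ( sup_{0 ≤ v ≤ s} |a(v) − b(v)| ) ds, where C_t = p μ₀₁ (1 + μ₁₁ t). -/
open MeasureTheory Set in
/-- The integrand defining `funcG` is interval integrable for `x` continuous on `[0, ∞)`. -/
lemma intervalIntegrable_funcG_integrand (μ11 c : ℝ) {x : ℝ → ℝ}
    (hx : ContinuousOn x (Ici 0)) {t : ℝ} (ht : 0 ≤ t) :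
    IntervalIntegrable
      (fun s => (x s + μ11 * ∫ v in (0:ℝ)..s, x v) * Real.exp (c * (t - s))) volume 0 t := by
  have hsub : uIcc 0 t ⊆ Ici 0 := by
    rw [uIcc_of_le ht]
    exact Icc_subset_Ici_self
  have hx' := hx.mono hsub
  have hprim : ContinuousOn (fun s => ∫ v in (0:ℝ)..s, x v) (uIcc 0 t) :=
    intervalIntegral.continuousOn_primitive_interval (hx'.integrableOn_compact isCompact_uIcc)
  apply ContinuousOn.intervalIntegrable
  fun_prop

open Set in
lemma ContinuousOn.bddAbove_abs_image_Icc {d : ℝ → ℝ} (hd : ContinuousOn d (Ici 0)) (s : ℝ) :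
    BddAbove ((fun v => |d v|) '' Icc 0 s) :=
  isCompact_Icc.bddAbove_image (hd.abs.mono Icc_subset_Ici_self)

open Set in
lemma ContinuousOn.monotoneOn_sSup_abs_image_Icc {d : ℝ → ℝ} (hd : ContinuousOn d (Ici 0)) :
    MonotoneOn (fun s => sSup ((fun v => |d v|) '' Icc 0 s)) (Ici 0) := fun _ hx y _ hxy =>
  csSup_le_csSup (hd.bddAbove_abs_image_Icc y) ((nonempty_Icc.2 hx).image _)
    (image_mono (Icc_subset_Icc_right hxy))

/-- for continuous `a, b : [0,∞) → ℝ` and every `t ≥ 0`,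
`sup_{0 ≤ s ≤ t} |G(a)(s) − G(b)(s)| ≤ C_t ∫₀ᵗ ( sup_{0 ≤ v ≤ s} |a(v) − b(v)| ) ds`,
with `C_t = p μ₀₁ (1 + μ₁₁ t)`. -/
theorem stmt_4 (p μ01 μ11 : ℝ)
    (hp0 : 0 < p) (hp1 : p < 1) (hμ01 : 0 < μ01) (hμ11 : 0 < μ11)
    (a b : ℝ → ℝ)
    (ha : ContinuousOn a (Set.Ici 0)) (hb : ContinuousOn b (Set.Ici 0)) :
    ∀ t ≥ (0 : ℝ),
      sSup ((fun s => |funcG p μ01 μ11 a s - funcG p μ01 μ11 b s|) '' Set.Icc 0 t)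
        ≤ p * μ01 * (1 + μ11 * t)
            * ∫ s in (0:ℝ)..t, sSup ((fun v => |a v - b v|) '' Set.Icc 0 s) := by
  intro t ht
  have hd : ContinuousOn (fun v => a v - b v) (Set.Ici 0) := ha.sub hb
  set S : ℝ → ℝ := fun s => sSup ((fun v => |a v - b v|) '' Set.Icc 0 s) with hS
  have hle : ∀ {v s : ℝ}, 0 ≤ v → v ≤ s → |a v - b v| ≤ S s := fun {v s} hv hvs =>
    le_csSup (hd.bddAbove_abs_image_Icc s) ⟨v, ⟨hv, hvs⟩, rfl⟩
  have hS0 : ∀ {s : ℝ}, 0 ≤ s → 0 ≤ S s := fun {s} hs =>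
    (abs_nonneg _).trans (hle le_rfl hs)
  have hSint : ∀ {u : ℝ}, 0 ≤ u → IntervalIntegrable S MeasureTheory.volume 0 u := by
    intro u hu
    refine MonotoneOn.intervalIntegrable (hd.monotoneOn_sSup_abs_image_Icc.mono ?_)
    rw [Set.uIcc_of_le hu]
    exact Set.Icc_subset_Ici_self
  have hint : ∀ {x : ℝ → ℝ}, ContinuousOn x (Set.Ici 0) → ∀ {r : ℝ}, 0 ≤ r →
      IntervalIntegrable x MeasureTheory.volume 0 r := by
    intro x hx r hr
    refine ContinuousOn.intervalIntegrable (hx.mono ?_)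
    rw [Set.uIcc_of_le hr]
    exact Set.Icc_subset_Ici_self
  refine csSup_le ((Set.nonempty_Icc.2 ht).image _) ?_
  rintro _ ⟨s, ⟨hs0, hst⟩, rfl⟩
  have hμ : 0 ≤ (1 - p) * μ01 + p * μ11 := by
    have := sub_pos.2 hp1
    positivity
  have hbound : ∀ r ∈ Set.Ioc 0 s,
      ‖(a r + μ11 * ∫ v in (0:ℝ)..r, a v) * Real.exp (-((1 - p) * μ01 + p * μ11) * (s - r))
        - (b r + μ11 * ∫ v in (0:ℝ)..r, b v) * Real.exp (-((1 - p) * μ01 + p * μ11) * (s - r))‖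
      ≤ (1 + μ11 * t) * S r := by
    rintro r ⟨hr0, hrs⟩
    have hprim : |∫ v in (0:ℝ)..r, (a v - b v)| ≤ S r * r := by
      have h := intervalIntegral.norm_integral_le_of_norm_le_const (a := 0) (b := r)
        (f := fun v => a v - b v) (C := S r) fun v hv => by
          rw [Set.uIoc_of_le hr0.le] at hv
          exact hle hv.1.le hv.2
      simpa [abs_of_pos hr0] using h
    have hexp : Real.exp (-((1 - p) * μ01 + p * μ11) * (s - r)) ≤ 1 := by
      rw [Real.exp_le_one_iff]
      nlinarith [mul_nonneg hμ (sub_nonneg.2 hrs)]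
    have hsum : |(a r - b r) + μ11 * ∫ v in (0:ℝ)..r, (a v - b v)| ≤ (1 + μ11 * t) * S r := by
      calc _ ≤ |a r - b r| + μ11 * |∫ v in (0:ℝ)..r, (a v - b v)| := by
            rw [← abs_of_pos hμ11, ← abs_mul, abs_of_pos hμ11]
            exact abs_add_le _ _
        _ ≤ S r + μ11 * (S r * t) := by
            have := hS0 hr0.le
            have hrt : r ≤ t := hrs.trans hst
            gcongr
            · exact hle hr0.le le_rfl
            · exact hprim.trans (by gcongr)
        _ = _ := by ring
    rw [← sub_mul, add_sub_add_comm, ← mul_sub,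
      ← intervalIntegral.integral_sub (hint ha hr0.le) (hint hb hr0.le), Real.norm_eq_abs,
      abs_mul, Real.abs_exp]
    exact (mul_le_of_le_one_right (abs_nonneg _) hexp).trans hsum
  have hpμ : 0 < p * μ01 := mul_pos hp0 hμ01
  have hmono : ∫ r in (0:ℝ)..s, S r ≤ ∫ r in (0:ℝ)..t, S r := by
    refine intervalIntegral.integral_mono_interval le_rfl hs0 hst ?_ (hSint ht)
    filter_upwards [MeasureTheory.ae_restrict_mem measurableSet_Ioc] with r hr
    exact hS0 hr.1.le
  simp only [funcG]
  rw [← mul_sub, ← intervalIntegral.integral_sub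
    (intervalIntegrable_funcG_integrand _ _ ha hs0) (intervalIntegrable_funcG_integrand _ _ hb hs0),
    abs_mul, abs_neg, abs_of_pos hpμ, mul_assoc (p * μ01)]
  refine mul_le_mul_of_nonneg_left ?_ hpμ.le
  calc _ ≤ ∫ r in (0:ℝ)..s, (1 + μ11 * t) * S r :=
        intervalIntegral.norm_integral_le_of_norm_le hs0
          (Filter.Eventually.of_forall hbound) ((hSint hs0).const_mul _)
    _ = (1 + μ11 * t) * ∫ r in (0:ℝ)..s, S r := intervalIntegral.integral_const_mul _ _
    _ ≤ _ := by gcongr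
end

section
/- Let t₁ > 0 and let y, z : [0,t₁] → ℝ be continuous with z(t₁) = 0. If for every s ∈ [0,t₁), μ₀₂ r (t₁ − s) − μ₀₂∫ₛ^{t₁} z(v) dv − μ₀₁∫ₛ^{t₁} y(v) dv ≤ 0, then μ₀₂ r ≤ μ₀₁·y(t₁). -/
/-- let `t₁ > 0` and `y, z : [0,t₁] → ℝ` continuous with `z(t₁) = 0`. If for
every `s ∈ [0,t₁)`, `μ₀₂ r (t₁ − s) − μ₀₂ ∫ₛ^{t₁} z(v) dv − μ₀₁ ∫ₛ^{t₁} y(v) dv ≤ 0`,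
then `μ₀₂ r ≤ μ₀₁ y(t₁)`. -/
theorem stmt_8 (μ01 μ02 r : ℝ) (hμ01 : 0 < μ01) (hμ02 : 0 < μ02) (hr : 0 < r)
    (t1 : ℝ) (ht1 : 0 < t1) (y z : ℝ → ℝ)
    (hy : ContinuousOn y (Set.Icc 0 t1)) (hz : ContinuousOn z (Set.Icc 0 t1))
    (hzt1 : z t1 = 0)
    (h : ∀ s ∈ Set.Ico (0 : ℝ) t1,
      μ02 * r * (t1 - s) - μ02 * (∫ v in s..t1, z v) - μ01 * (∫ v in s..t1, y v) ≤ 0) :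
    μ02 * r ≤ μ01 * y t1 := by
  by_contra! hlt
  set g : ℝ → ℝ := fun v => μ02 * r - μ02 * z v - μ01 * y v with hg
  have hgc : ContinuousOn g (Set.Icc 0 t1) :=
    (continuousOn_const.sub (continuousOn_const.mul hz)).sub (continuousOn_const.mul hy)
  have hg1 : 0 < g t1 := by simp only [hg, hzt1]; linarith
  have hev : ∀ᶠ v in nhdsWithin t1 (Set.Iic t1), 0 < g v := by
    rw [← nhdsWithin_Icc_eq_nhdsLE ht1]
    exact (hgc t1 (Set.right_mem_Icc.2 ht1.le)).eventually (lt_mem_nhds hg1)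
  obtain ⟨s, hs, hpos⟩ := (mem_nhdsLE_iff_exists_mem_Ico_Ioc_subset ht1).1 hev
  have hsub : Set.uIcc s t1 ⊆ Set.Icc 0 t1 := by
    rw [Set.uIcc_of_le hs.2.le]
    exact Set.Icc_subset_Icc_left hs.1
  have hzi : IntervalIntegrable z MeasureTheory.volume s t1 :=
    (hz.mono hsub).intervalIntegrable
  have hyi : IntervalIntegrable y MeasureTheory.volume s t1 :=
    (hy.mono hsub).intervalIntegrable
  have hint : 0 < ∫ v in s..t1, g v :=
    intervalIntegral.intervalIntegral_pos_of_pos_on (hgc.mono hsub).intervalIntegrable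
      (fun v hv => hpos ⟨hv.1, hv.2.le⟩) hs.2
  have heq : ∫ v in s..t1, g v =
      μ02 * r * (t1 - s) - μ02 * (∫ v in s..t1, z v) - μ01 * (∫ v in s..t1, y v) := by
    simp only [hg]
    rw [intervalIntegral.integral_sub (intervalIntegrable_const.sub (hzi.const_mul _))
        (hyi.const_mul _),
      intervalIntegral.integral_sub intervalIntegrable_const (hzi.const_mul _),
      intervalIntegral.integral_const, intervalIntegral.integral_const_mul,
      intervalIntegral.integral_const_mul, smul_eq_mul, mul_comm (t1 - s)]
  linarith [h s hs]
end

section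
/- Let T ≥ 0 and let (y*, y) : [T,∞) → ℝ² be differentiable functions satisfying, for all t ≥ T, dy*/dt (t) = μ₀₁ y(t) − μ₀₂ r and dy/dt (t) = −(μ₀₁ + pμ₁₁) y(t) − pμ₁₁ y*(t) + p(μ₀₂ r + μ₁₁). Then as t → ∞, (y*(t), y(t)) converges to ( 1 − (μ₀₂ r/μ₀₁)·( (1−p)μ₀₁/(pμ₁₁) + 1 ) , μ₀₂ r/μ₀₁ ), which is moreover the unique stationary point of this linear system. -/
open Filter Topology in
/-- A nonnegative function with `V' ≤ -c V`, `c > 0`, on `[T, ∞)` tends to zero. -/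
theorem tendsto_zero_of_hasDerivAt_le_neg_mul {V V' : ℝ → ℝ} {c T : ℝ} (hc : 0 < c)
    (hV : ∀ t, 0 ≤ V t) (hd : ∀ t ≥ T, HasDerivAt V (V' t) t)
    (hle : ∀ t ≥ T, V' t ≤ -c * V t) : Tendsto V atTop (𝓝 0) := by
  have hW : ∀ t ≥ T, HasDerivAt (fun s => V s * Real.exp (c * s))
      (V' t * Real.exp (c * t) + V t * (Real.exp (c * t) * c)) t := fun t ht => by
    have he : HasDerivAt (fun s => c * s) c t := by simpa using (hasDerivAt_id t).const_mul c
    exact (hd t ht).mul he.exp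
  have hanti : AntitoneOn (fun s => V s * Real.exp (c * s)) (Set.Ici T) := by
    refine antitoneOn_of_deriv_nonpos (convex_Ici T)
      (fun t ht => (hW t ht).continuousAt.continuousWithinAt) ?_ ?_
    · intro t ht
      exact (hW t (interior_subset ht)).differentiableAt.differentiableWithinAt
    · intro t ht
      have ht' : t ≥ T := interior_subset ht
      rw [(hW t ht').deriv]
      nlinarith [hle t ht', Real.exp_pos (c * t)]
  have hlim : Tendsto (fun t => V T * Real.exp (c * T) * Real.exp (-(c * t))) atTop (𝓝 0) := by
    have h := Real.tendsto_exp_neg_atTop_nhds_zero.comp (tendsto_id.const_mul_atTop hc)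
    simpa using h.const_mul (V T * Real.exp (c * T))
  refine squeeze_zero' (Eventually.of_forall hV) ?_ hlim
  filter_upwards [eventually_ge_atTop T] with t ht
  have h : V t * Real.exp (c * t) ≤ V T * Real.exp (c * T) :=
    hanti Set.self_mem_Ici ht ht
  rw [Real.exp_neg, ← div_eq_mul_inv]
  exact (le_div_iff₀ (Real.exp_pos _)).2 h

open Filter Topology in
theorem tendsto_of_sq_sub_le {f V : ℝ → ℝ} {a : ℝ} (hV : Tendsto V atTop (𝓝 0))
    (h : ∀ t, (f t - a) ^ 2 ≤ V t) : Tendsto f atTop (𝓝 a) := by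
  rw [tendsto_iff_dist_tendsto_zero]
  refine squeeze_zero (fun _ => dist_nonneg) (fun t => ?_) (by simpa using hV.sqrt)
  exact Real.abs_le_sqrt (h t)

open Filter Topology in
/-- Solutions of `u' = α v`, `v' = -(α + β) v - β u`, translated to an equilibrium `(a, b)`,
converge to it when `α, β > 0`. -/
theorem tendsto_equilibrium_of_hasDerivAt {α β a b T : ℝ} (hα : 0 < α) (hβ : 0 < β)
    {x y : ℝ → ℝ} (hx : ∀ t ≥ T, HasDerivAt x (α * (y t - b)) t)
    (hy : ∀ t ≥ T, HasDerivAt y (-(α + β) * (y t - b) - β * (x t - a)) t) :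
    Tendsto x atTop (𝓝 a) ∧ Tendsto y atTop (𝓝 b) := by
  set w : ℝ → ℝ := fun t => x t + y t with hw
  have hwd : ∀ t ≥ T, HasDerivAt w (-β * (w t - (a + b))) t := fun t ht =>
    ((hx t ht).add (hy t ht)).congr_deriv (by simp only [hw]; ring)
  have hV : Tendsto (fun t => β * (x t - a) ^ 2 + α * (w t - (a + b)) ^ 2) atTop (𝓝 0) := by
    refine tendsto_zero_of_hasDerivAt_le_neg_mul (c := min α β) (T := T) (lt_min hα hβ)
      (fun t => by positivity)
      (fun t ht => ((((hx t ht).sub_const a).pow 2).const_mul β).add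
        ((((hwd t ht).sub_const (a + b)).pow 2).const_mul α)) (fun t ht => ?_)
    have hyw : y t - b = (w t - (a + b)) - (x t - a) := by simp only [hw]; ring
    rw [hyw]
    generalize x t - a = u
    generalize w t - (a + b) = z
    have h1 : min α β * (β * u ^ 2) ≤ α * (β * u ^ 2) := by
      gcongr; exact min_le_left _ _
    have h2 : min α β * (α * z ^ 2) ≤ β * (α * z ^ 2) := by
      gcongr; exact min_le_right _ _
    have h3 : 0 ≤ α * β * (u - z) ^ 2 := by positivity
    norm_num
    nlinarith
  have hxlim : Tendsto x atTop (𝓝 a) := by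
    refine tendsto_of_sq_sub_le (by simpa using hV.const_mul β⁻¹) (fun t => ?_)
    rw [← div_eq_inv_mul, le_div_iff₀ hβ]
    nlinarith [mul_nonneg hα.le (sq_nonneg (w t - (a + b)))]
  have hwlim : Tendsto w atTop (𝓝 (a + b)) := by
    refine tendsto_of_sq_sub_le (by simpa using hV.const_mul α⁻¹) (fun t => ?_)
    rw [← div_eq_inv_mul, le_div_iff₀ hα]
    nlinarith [mul_nonneg hβ.le (sq_nonneg (x t - a))]
  exact ⟨hxlim, by simpa [hw] using hwlim.sub hxlim⟩

/-- if `(y*, y)` solves on `[T,∞)` the linear system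
`dy*/dt = μ₀₁ y − μ₀₂ r`, `dy/dt = −(μ₀₁+pμ₁₁) y − pμ₁₁ y* + p(μ₀₂ r + μ₁₁)`, then
`(y*(t), y(t)) → ( 1 − (μ₀₂ r/μ₀₁)((1−p)μ₀₁/(pμ₁₁) + 1), μ₀₂ r/μ₀₁ )` as `t → ∞`,
and this limit is the unique stationary point of the system. -/
theorem stmt_10 (p μ01 μ11 μ02 r : ℝ)
    (hp0 : 0 < p) (hp1 : p < 1) (hμ01 : 0 < μ01) (hμ11 : 0 < μ11) (hμ02 : 0 < μ02)
    (hr : 0 < r)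
    (T : ℝ) (hT : 0 ≤ T) (ystar y : ℝ → ℝ)
    (hode : ∀ t ≥ T,
      HasDerivAt ystar (μ01 * y t - μ02 * r) t ∧
      HasDerivAt y (-(μ01 + p * μ11) * y t - p * μ11 * ystar t
        + p * (μ02 * r + μ11)) t) :
    Filter.Tendsto (fun t => (ystar t, y t)) Filter.atTop
      (nhds (1 - μ02 * r / μ01 * ((1 - p) * μ01 / (p * μ11) + 1), μ02 * r / μ01)) ∧
    (∀ a b : ℝ,
      (μ01 * b - μ02 * r = 0 ∧
        -(μ01 + p * μ11) * b - p * μ11 * a + p * (μ02 * r + μ11) = 0) ↔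
      (a = 1 - μ02 * r / μ01 * ((1 - p) * μ01 / (p * μ11) + 1) ∧ b = μ02 * r / μ01)) := by
  constructor
  · obtain ⟨h1, h2⟩ := tendsto_equilibrium_of_hasDerivAt (T := T)
      (a := 1 - μ02 * r / μ01 * ((1 - p) * μ01 / (p * μ11) + 1)) (b := μ02 * r / μ01)
      hμ01 (mul_pos hp0 hμ11)
      (fun t ht => (hode t ht).1.congr_deriv (by field_simp))
      (fun t ht => (hode t ht).2.congr_deriv (by field_simp; ring))
    exact h1.prodMk_nhds h2
  · intro a b
    constructor
    · rintro ⟨h1, h2⟩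
      have hb : b = μ02 * r / μ01 := by
        rw [eq_div_iff hμ01.ne']
        linarith
      refine ⟨?_, hb⟩
      subst hb
      field_simp at h2 ⊢
      linarith
    · rintro ⟨rfl, rfl⟩
      constructor <;> field_simp <;> ring
end

section
/- Let T ≥ 0 and let (y, z) : [T,∞) → ℝ² be differentiable functions satisfying, for all t ≥ T, dy/dt (t) = −(pμ₁₁ + (1−p)μ₀₁)·y(t) + pμ₁₁ and dz/dt (t) = −μ₀₂ z(t) − μ₀₁ y(t) + μ₀₂ r. Then as t → ∞, (y(t), z(t)) converges to ( pμ₁₁/(pμ₁₁ + (1−p)μ₀₁) , r − pμ₀₁μ₁₁/( μ₀₂ (pμ₁₁ + (1−p)μ₀₁) ) ). -/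
/-- A solution of `f' = -k f + g` with `k > 0` and `g → G` is eventually below any `c > G / k`. -/
theorem eventually_lt_of_hasDerivAt_neg_mul_add {k G T c : ℝ} {f g : ℝ → ℝ} (hk : 0 < k)
    (hf : ∀ t ≥ T, HasDerivAt f (-k * f t + g t) t)
    (hg : Filter.Tendsto g Filter.atTop (nhds G)) (hc : G / k < c) :
    ∀ᶠ t in Filter.atTop, f t < c := by
  obtain ⟨d, hd, hdc⟩ := exists_between hc
  have hGd : G < k * d := by rwa [div_lt_iff₀' hk] at hd
  obtain ⟨S, hS⟩ := Filter.eventually_atTop.1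
    ((hg.eventually_lt_const hGd).and (Filter.eventually_ge_atTop T))
  have hderiv : ∀ t ≥ S, HasDerivAt (fun t => (f t - d) * Real.exp (k * t))
      ((g t - k * d) * Real.exp (k * t)) t := by
    intro t ht
    have he : HasDerivAt (fun t => Real.exp (k * t)) (Real.exp (k * t) * k) t := by
      simpa using ((hasDerivAt_id t).const_mul k).exp
    exact (((hf t (hS t ht).2).sub_const d).mul he).congr_deriv (by ring)
  have hanti : AntitoneOn (fun t => (f t - d) * Real.exp (k * t)) (Set.Ici S) := by
    refine antitoneOn_of_hasDerivWithinAt_nonpos (convex_Ici S)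
      (fun t ht => (hderiv t ht).continuousAt.continuousWithinAt)
      (fun t ht => (hderiv t (interior_subset ht)).hasDerivWithinAt) fun t ht => ?_
    have := (hS t (interior_subset ht)).1
    exact mul_nonpos_of_nonpos_of_nonneg (by linarith) (Real.exp_pos _).le
  set C := (f S - d) * Real.exp (k * S)
  have hlim : Filter.Tendsto (fun t => C * Real.exp (-(k * t))) Filter.atTop (nhds 0) := by
    simpa using (Real.tendsto_exp_neg_atTop_nhds_zero.comp
      (Filter.tendsto_id.const_mul_atTop hk)).const_mul C
  filter_upwards [hlim.eventually_lt_const (sub_pos.2 hdc), Filter.eventually_ge_atTop S]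
    with t ht htS
  have hle : (f t - d) * Real.exp (k * t) ≤ C := hanti Set.self_mem_Ici htS htS
  rw [Real.exp_neg, ← div_eq_mul_inv] at ht
  have := (le_div_iff₀ (Real.exp_pos _)).2 hle
  linarith

/-- A solution of `f' = -k f + g` with `k > 0` and `g → G` converges to `G / k`. -/
theorem tendsto_of_hasDerivAt_neg_mul_add {k G T : ℝ} {f g : ℝ → ℝ} (hk : 0 < k)
    (hf : ∀ t ≥ T, HasDerivAt f (-k * f t + g t) t)
    (hg : Filter.Tendsto g Filter.atTop (nhds G)) :
    Filter.Tendsto f Filter.atTop (nhds (G / k)) := by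
  refine tendsto_order.2 ⟨fun c hc => ?_,
    fun c hc => eventually_lt_of_hasDerivAt_neg_mul_add hk hf hg hc⟩
  have hneg : ∀ t ≥ T, HasDerivAt (fun t => -f t) (-k * -f t + -g t) t := by
    intro t ht
    exact (hf t ht).neg.congr_deriv (by ring)
  filter_upwards [eventually_lt_of_hasDerivAt_neg_mul_add hk hneg hg.neg
    (c := -c) (by rw [neg_div]; linarith)] with t ht
  linarith


/-- if `(y, z)` solves on `[T,∞)` the linear system
`dy/dt = −(pμ₁₁+(1−p)μ₀₁) y + pμ₁₁`, `dz/dt = −μ₀₂ z − μ₀₁ y + μ₀₂ r`, then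
`(y(t), z(t)) → ( pμ₁₁/(pμ₁₁+(1−p)μ₀₁), r − pμ₀₁μ₁₁/(μ₀₂(pμ₁₁+(1−p)μ₀₁)) )`
as `t → ∞`. -/
theorem stmt_13 (p μ01 μ11 μ02 r : ℝ)
    (hp0 : 0 < p) (hp1 : p < 1) (hμ01 : 0 < μ01) (hμ11 : 0 < μ11) (hμ02 : 0 < μ02)
    (hr : 0 < r)
    (T : ℝ) (hT : 0 ≤ T) (y z : ℝ → ℝ)
    (hode : ∀ t ≥ T,
      HasDerivAt y (-(p * μ11 + (1 - p) * μ01) * y t + p * μ11) t ∧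
      HasDerivAt z (-μ02 * z t - μ01 * y t + μ02 * r) t) :
    Filter.Tendsto (fun t => (y t, z t)) Filter.atTop
      (nhds (p * μ11 / (p * μ11 + (1 - p) * μ01),
        r - p * μ01 * μ11 / (μ02 * (p * μ11 + (1 - p) * μ01)))) := by
  have hk : 0 < p * μ11 + (1 - p) * μ01 := by
    have := sub_pos.2 hp1
    positivity
  have hy := tendsto_of_hasDerivAt_neg_mul_add hk (fun t ht => (hode t ht).1) tendsto_const_nhds
  have hz := tendsto_of_hasDerivAt_neg_mul_add (T := T) (f := z)
    (g := fun t => μ02 * r - μ01 * y t) hμ02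
    (fun t ht => (hode t ht).2.congr_deriv (by ring))
    ((hy.const_mul μ01).const_sub (μ02 * r))
  convert hy.prodMk_nhds hz using 3
  field_simp
end

section
/- Let C₁ ≥ 1 and C₂ ≥ 1 be integers, p ∈ (0,1), and μ₀₁, μ₁₁, μ₀₂ > 0. Consider the finite state space S = { (y*, y, z) ∈ ℕ³ : y + y* ≤ C₁, z ≤ C₂, y*·z = 0 } and the transition relation on S in which a state x = (y*, y, z) can jump to another state exactly via the transitions with positive rate: x → (y*+1, y−1, 0) if y ≥ 1 and z = 0; x → (0, y−1, z−1) and x → (0, y, z−1) if y ≥ 1 and z ≥ 1 (the first additionally requires y ≥ 1); x → (y*, y+1, z) if y* + y < C₁; x → (y*−1, y, z) and x → (y*−1, y+1, z) if y* ≥ 1; x → (0, y, z+1) if y* = 0 and z < C₂. Then this transition relation is irreducible on S: for any two states x, x′ ∈ S there is a finite sequence of such transitions leading from x to x′. -/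
/-- The state space of the call-center Markov process: states `(y*, y, z) ∈ ℕ³` with
`y + y* ≤ C₁`, `z ≤ C₂`, `y*·z = 0`. -/
def CallState (C1 C2 : ℕ) : Set (ℕ × ℕ × ℕ) :=
  {x | x.2.1 + x.1 ≤ C1 ∧ x.2.2 ≤ C2 ∧ x.1 * x.2.2 = 0}

/-- One-step transition relation of the call-center Markov process: a state
`x = (y*, y, z)` jumps to `x'` exactly via the transitions of positive rate. -/
def CallStep (C1 C2 : ℕ) (x x' : ℕ × ℕ × ℕ) : Prop :=
  let ys := x.1; let y := x.2.1; let z := x.2.2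
  (1 ≤ y ∧ z = 0 ∧ x' = (ys + 1, y - 1, 0)) ∨
  (1 ≤ y ∧ 1 ≤ z ∧ x' = (0, y - 1, z - 1)) ∨
  (1 ≤ y ∧ 1 ≤ z ∧ x' = (0, y, z - 1)) ∨
  (ys + y < C1 ∧ x' = (ys, y + 1, z)) ∨
  (1 ≤ ys ∧ x' = (ys - 1, y, z)) ∨
  (1 ≤ ys ∧ x' = (ys - 1, y + 1, z)) ∨
  (ys = 0 ∧ z < C2 ∧ x' = (0, y, z + 1))

open Relation in
/-- Every state with `z = 0` can release all its blocked jobs. -/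
theorem reach_unblocked (C1 C2 y k : ℕ) :
    ReflTransGen (CallStep C1 C2) (k, y, 0) (0, y, 0) := by
  induction k with
  | zero => exact .refl
  | succ k ih => exact .head (by simp [CallStep]) ih

open Relation in
/-- Idle level-1 servers can pick up class-0 jobs one after another. -/
theorem reach_more_service (C1 C2 y z k : ℕ) (h : y + k ≤ C1) :
    ReflTransGen (CallStep C1 C2) (0, y, z) (0, y + k, z) := by
  induction k with
  | zero => exact .refl
  | succ k ih =>
    refine .tail (ih (by omega)) ?_
    have : y + k < C1 := by omega
    simp [CallStep, this, Nat.add_assoc]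

open Relation in
/-- As long as a class-0 job is in service, all level-2 servers can become busy. -/
theorem reach_no_idle (C1 C2 y z : ℕ) (hy : 1 ≤ y) :
    ReflTransGen (CallStep C1 C2) (0, y, z) (0, y, 0) := by
  induction z with
  | zero => exact .refl
  | succ z ih => exact .head (by simp [CallStep, hy]) ih

open Relation in
/-- When no level-2 server is idle, jobs in service can become blocked. -/
theorem reach_blocked (C1 C2 b k : ℕ) :
    ReflTransGen (CallStep C1 C2) (0, b + k, 0) (k, b, 0) := by
  induction k generalizing b with
  | zero => exact .refl
  | succ k ih =>
    have h := ih (b + 1)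
    rw [Nat.add_right_comm, Nat.add_assoc] at h
    exact h.tail (by simp [CallStep])

open Relation in
/-- When no job is blocked, level-2 servers can become idle. -/
theorem reach_idle (C1 C2 y z : ℕ) (h : z ≤ C2) :
    ReflTransGen (CallStep C1 C2) (0, y, 0) (0, y, z) := by
  induction z with
  | zero => exact .refl
  | succ z ih =>
    refine .tail (ih (by omega)) ?_
    have : z < C2 := by omega
    simp [CallStep, this]

open Relation in
/-- The state with all level-1 servers in service and all level-2 servers busy is reachable
from every state. -/
theorem reach_full (C1 C2 : ℕ) (hC1 : 1 ≤ C1) {x : ℕ × ℕ × ℕ} (hx : x ∈ CallState C1 C2) :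
    ReflTransGen (CallStep C1 C2) x (0, C1, 0) := by
  obtain ⟨a, b, c⟩ := x
  obtain ⟨hab, -, hac⟩ := hx
  dsimp only at hab hac
  have key : ReflTransGen (CallStep C1 C2) (0, b, c) (0, C1, 0) := by
    have h := reach_more_service C1 C2 b c (C1 - b) (by omega)
    rw [show b + (C1 - b) = C1 by omega] at h
    exact h.trans (reach_no_idle C1 C2 C1 c hC1)
  rcases Nat.mul_eq_zero.mp hac with rfl | rfl
  · exact key
  · exact (reach_unblocked C1 C2 b a).trans key

open Relation in
/-- Every state is reachable from the state with all level-1 servers in service and all level-2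
servers busy. -/
theorem reach_of_full (C1 C2 : ℕ) {x : ℕ × ℕ × ℕ} (hx : x ∈ CallState C1 C2) :
    ReflTransGen (CallStep C1 C2) (0, C1, 0) x := by
  obtain ⟨a, b, c⟩ := x
  obtain ⟨hab, hc, hac⟩ := hx
  dsimp only at hab hc hac
  have h_service (n : ℕ) (hn : n ≤ C1) :
      ReflTransGen (CallStep C1 C2) (0, C1, 0) (0, n, 0) := by
    have h := reach_blocked C1 C2 n (C1 - n)
    rw [show n + (C1 - n) = C1 by omega] at h
    exact h.trans (reach_unblocked C1 C2 n _)
  rcases Nat.mul_eq_zero.mp hac with rfl | rfl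
  · exact (h_service b (by omega)).trans (reach_idle C1 C2 b c hc)
  · exact (h_service (b + a) hab).trans (reach_blocked C1 C2 b a)

/-- for integers `C₁, C₂ ≥ 1` the transition relation is irreducible on the
state space: any state of `S` can be reached from any other by a finite sequence of
transitions. -/
theorem stmt_15 (C1 C2 : ℕ) (hC1 : 1 ≤ C1) (hC2 : 1 ≤ C2) :
    ∀ x ∈ CallState C1 C2, ∀ x' ∈ CallState C1 C2,
      Relation.ReflTransGen (CallStep C1 C2) x x' := by
  intro x hx x' hx'
  exact (reach_full C1 C2 hC1 hx).trans (reach_of_full C1 C2 hx')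
end
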